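/- Let V be the ℚ-vector space with basis {f₁, f₂, f₃} ∪ {l_{i,j,k} : i,j,k ∈ {1,2,3}} (so dim V = 30), and set A¹_{i,j} = (1/3)(f₁ − Σ_{a=1}^{3} l_{a,i,j}) and A²_{i,j} = (1/3)(f₂ − Σ_{a=1}^{3} l_{i,a,j}). Then the ℚ-span of the 18 vectors {A¹_{i,j}, A²_{i,j} : i,j ∈ {1,2,3}} has dimension 16; equivalently, the kernel of the linear map ℚ¹⁸ → V, (λ^k_{i,j}) ↦ Σ λ^k_{i,j} A^k_{i,j}, has dimension 2. -/

import Mathlib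

/-- The 30-dimensional ℚ-vector space with basis `{f₁,f₂,f₃} ∪ {l_{i,j,k}}`. -/
abbrev V : Type := (Fin 3 ⊕ Fin 3 × Fin 3 × Fin 3) → ℚ

/-- The basis vector `f_k`. -/
def f (k : Fin 3) : V := Pi.single (Sum.inl k) 1

/-- The basis vector `l_{i,j,k}`. -/
def l (i j k : Fin 3) : V := Pi.single (Sum.inr (i, j, k)) 1

/-- The classes `A^k_{i,j}` of the 27 contracted rational curves. -/
def A (k i j : Fin 3) : V :=
  (1 / 3 : ℚ) • (f k - ∑ a : Fin 3,
    l (if k = 0 then a else i)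
      (if k = 0 then i else if k = 1 then a else j)
      (if k = 2 then a else j))

/-- The family `(A¹_{i,j}, A²_{i,j})` indexed by `Fin 2 × Fin 3 × Fin 3`. -/
def curveClass (p : Fin 2 × Fin 3 × Fin 3) : V :=
  A (Fin.castLE (by norm_num) p.1) p.2.1 p.2.2

lemma A_apply_inl (k i j m : Fin 3) : A k i j (Sum.inl m) = if m = k then 1 / 3 else 0 := by
  simp [A, f, l, Pi.single_apply]

lemma A_zero_apply_inr (i j a b c : Fin 3) :
    A 0 i j (Sum.inr (a, b, c)) = if i = b then if j = c then -(1 / 3) else 0 else 0 := by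
  fin_cases a <;> simp [A, f, l, Pi.single_apply, Fin.sum_univ_three, eq_comm, ite_and] <;>
    split_ifs <;> simp

lemma A_one_apply_inr (i j a b c : Fin 3) :
    A 1 i j (Sum.inr (a, b, c)) = if i = a then if j = c then -(1 / 3) else 0 else 0 := by
  fin_cases b <;> simp [A, f, l, Pi.single_apply, Fin.sum_univ_three, eq_comm, ite_and] <;>
    split_ifs <;> simp

lemma linearCombination_curveClass_apply_inl (w : Fin 2 × Fin 3 × Fin 3 → ℚ) (m : Fin 3) :
    Fintype.linearCombination ℚ curveClass w (Sum.inl m) =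
      ∑ k : Fin 2, if m = Fin.castLE (by norm_num) k then
        (1 / 3) * ∑ i : Fin 3, ∑ j : Fin 3, w (k, i, j) else 0 := by
  simp only [Fintype.linearCombination_apply, Finset.sum_apply, Pi.smul_apply, smul_eq_mul,
    curveClass, A_apply_inl, Fintype.sum_prod_type]
  refine Finset.sum_congr rfl fun k _ => ?_
  split_ifs
  · simp only [Finset.mul_sum, mul_comm]
  · simp

lemma linearCombination_curveClass_apply_inr (w : Fin 2 × Fin 3 × Fin 3 → ℚ) (a b c : Fin 3) :
    Fintype.linearCombination ℚ curveClass w (Sum.inr (a, b, c)) =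
      -(1 / 3) * (w (0, b, c) + w (1, a, c)) := by
  have h0 : (Fin.castLE (by norm_num) (0 : Fin 2) : Fin 3) = 0 := rfl
  have h1 : (Fin.castLE (by norm_num) (1 : Fin 2) : Fin 3) = 1 := rfl
  simp only [Fintype.linearCombination_apply, Finset.sum_apply, Pi.smul_apply, smul_eq_mul,
    curveClass, Fintype.sum_prod_type, Fin.sum_univ_two, h0, h1, A_zero_apply_inr,
    A_one_apply_inr, mul_ite, mul_zero, Finset.sum_ite_irrel, Finset.sum_const_zero,
    Finset.sum_ite_eq', Finset.mem_univ, if_true]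
  ring

/-- The relations `λ¹_{i,j} = μ_j`, `λ²_{i,j} = -μ_j` with `μ₁ + μ₂ + μ₃ = 0`,
parametrized by `(μ₁, μ₂)`. -/
def curveRelation : (Fin 2 → ℚ) →ₗ[ℚ] (Fin 2 × Fin 3 × Fin 3 → ℚ) where
  toFun μ p := ![1, -1] p.1 * ![μ 0, μ 1, -μ 0 - μ 1] p.2.2
  map_add' μ ν := by
    ext ⟨k, i, j⟩
    fin_cases j <;> simp <;> ring
  map_smul' r μ := by
    ext ⟨k, i, j⟩
    fin_cases j <;> simp <;> ring

lemma curveRelation_injective : Function.Injective curveRelation := by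
  intro μ ν h
  ext k
  fin_cases k
  · simpa [curveRelation] using congrFun h (0, 0, 0)
  · simpa [curveRelation] using congrFun h (0, 0, 1)

lemma ker_linearCombination_curveClass :
    LinearMap.ker (Fintype.linearCombination ℚ curveClass) = LinearMap.range curveRelation := by
  ext w
  rw [LinearMap.mem_ker, LinearMap.mem_range]
  constructor
  · intro h
    have hl (a b c : Fin 3) : w (0, b, c) + w (1, a, c) = 0 := by
      simpa [linearCombination_curveClass_apply_inr] using congrFun h (Sum.inr (a, b, c))
    have hc (b c : Fin 3) : w (0, b, c) = w (0, 0, c) := by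
      linarith [hl 0 b c, hl 0 0 c]
    have hf : w (0, 0, 0) + w (0, 0, 1) + w (0, 0, 2) = 0 := by
      have := congrFun h (Sum.inl 0)
      simp [linearCombination_curveClass_apply_inl, Fin.sum_univ_three, Fin.ext_iff] at this
      linarith [hc 1 0, hc 1 1, hc 1 2, hc 2 0, hc 2 1, hc 2 2]
    refine ⟨![w (0, 0, 0), w (0, 0, 1)], ?_⟩
    ext ⟨k, i, j⟩
    have h0 := hc i j
    have h1 := hl i 0 j
    fin_cases k <;> fin_cases j <;> simp [curveRelation] at h0 h1 ⊢ <;> linarith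
  · rintro ⟨μ, rfl⟩
    ext x
    rcases x with m | ⟨a, b, c⟩
    · rw [linearCombination_curveClass_apply_inl]
      simp [curveRelation, Fin.sum_univ_three]
      split_ifs <;> ring
    · rw [linearCombination_curveClass_apply_inr]
      simp [curveRelation]

theorem span_A12_rank_eq_16 :
    Module.finrank ℚ (Submodule.span ℚ
      (Set.range fun p : Fin 2 × Fin 3 × Fin 3 =>
        A (Fin.castLE (by norm_num) p.1) p.2.1 p.2.2)) = 16 := by
  change Module.finrank ℚ (Submodule.span ℚ (Set.range curveClass)) = 16
  rw [← Fintype.range_linearCombination]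
  have h := (Fintype.linearCombination ℚ curveClass).finrank_range_add_finrank_ker
  rw [ker_linearCombination_curveClass,
    LinearMap.finrank_range_of_inj curveRelation_injective] at h
  simp at h
  omega
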